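/- There exists an absolute constant C ≥ 1 such that the following holds. Suppose α : G⁵ → 𝔽₂ is a multilinear form such that: (a) α is symmetric in its first 3 variables; (b) prank(α + α∘(3 4)) ≤ r. Then there exists a multilinear form α' : G⁵ → 𝔽₂ which is symmetric in its first 4 variables and satisfies prank(α + α') ≤ exp(exp(C·r^C)). -/

import Mathlib

open Finset

/-- `β : (Fin k → V) → ZMod 2` is a multilinear form in the variables indexed by `S`:
it depends only on the coordinates in `S` and is additive (hence `𝔽₂`-linear) in each of
those coordinates. -/
def MultilinearOn {V : Type*} [AddCommGroup V] [Module (ZMod 2) V] (k : ℕ)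
    (S : Finset (Fin k)) (β : (Fin k → V) → ZMod 2) : Prop :=
  (∀ x y : Fin k → V, (∀ i ∈ S, x i = y i) → β x = β y) ∧
  (∀ i ∈ S, ∀ (x : Fin k → V) (u v : V),
    β (Function.update x i (u + v)) = β (Function.update x i u) + β (Function.update x i v))

/-- A multilinear form in all `k` variables. -/
def IsMultilinear {V : Type*} [AddCommGroup V] [Module (ZMod 2) V] (k : ℕ)
    (α : (Fin k → V) → ZMod 2) : Prop :=
  MultilinearOn k Finset.univ α

/-- `α`, a multilinear form in the variables indexed by `S`, admits a partition-rank
decomposition with `m` terms. -/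
def PrankDecompOn {V : Type*} [AddCommGroup V] [Module (ZMod 2) V] (k : ℕ)
    (S : Finset (Fin k)) (m : ℕ) (α : (Fin k → V) → ZMod 2) : Prop :=
  ∃ (I : Fin m → Finset (Fin k)) (β γ : Fin m → ((Fin k → V) → ZMod 2)),
    (∀ i, I i ⊆ S) ∧ (∀ i, I i ≠ ∅) ∧ (∀ i, I i ≠ S) ∧
    (∀ i, MultilinearOn k (I i) (β i)) ∧
    (∀ i, MultilinearOn k (S \ I i) (γ i)) ∧
    (∀ x, α x = ∑ i, β i x * γ i x)

/-- The partition rank of a multilinear form in the variables indexed by `S`. -/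
noncomputable def prankOn {V : Type*} [AddCommGroup V] [Module (ZMod 2) V] (k : ℕ)
    (S : Finset (Fin k)) (α : (Fin k → V) → ZMod 2) : ℕ :=
  sInf {m | PrankDecompOn k S m α}

/-- The partition rank of a multilinear form in `k` variables. -/
noncomputable def prank {V : Type*} [AddCommGroup V] [Module (ZMod 2) V] (k : ℕ)
    (α : (Fin k → V) → ZMod 2) : ℕ :=
  prankOn k Finset.univ α

/-- `α ∘ π`: the form `(x₁, …, x_k) ↦ α(x_{π⁻¹(1)}, …, x_{π⁻¹(k)})`. -/
def permForm {V : Type*} (k : ℕ) (π : Equiv.Perm (Fin k))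
    (α : (Fin k → V) → ZMod 2) : (Fin k → V) → ZMod 2 :=
  fun x => α (fun i => x (π.symm i))

/-- `α` is symmetric in its first `m` variables (0-indexed: coordinates `< m`). -/
def SymmetricInFirst {V : Type*} (k m : ℕ) (α : (Fin k → V) → ZMod 2) : Prop :=
  ∀ i j : Fin k, (i : ℕ) < m → (j : ℕ) < m → permForm k (Equiv.swap i j) α = α

/-- `α` is symmetric in all of its variables. -/
def SymmetricForm {V : Type*} (k : ℕ) (α : (Fin k → V) → ZMod 2) : Prop :=
  ∀ π : Equiv.Perm (Fin k), permForm k π α = α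

/-- `σ` is strongly symmetric: it is symmetric, and the form
`(x, y₃, …, y_k) ↦ σ(x, x, y₃, …, y_k)` is also symmetric.  (Given the symmetry of `σ`,
the latter is equivalent to being allowed to swap the doubled variable with the third
variable, which is how it is stated here.) -/
def StronglySymmetric {V : Type*} (k : ℕ) (σ : (Fin k → V) → ZMod 2) : Prop :=
  SymmetricForm k σ ∧
  ∀ (u v : V) (z : Fin k → V),
    σ (fun i => if (i : ℕ) = 0 ∨ (i : ℕ) = 1 then u else if (i : ℕ) = 2 then v else z i) =
    σ (fun i => if (i : ℕ) = 0 ∨ (i : ℕ) = 1 then v else if (i : ℕ) = 2 then u else z i)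

section Core

variable {V : Type*} [AddCommGroup V] [Module (ZMod 2) V]

/-- If a finite sum of products `g i u v * T i x y z` vanishes whenever `x, y, z` satisfy boundedly
many linear conditions depending on `u, v`, then it vanishes as soon as `x, y, z` satisfy boundedly
many linear conditions which do not depend on `u, v`. -/
lemma exists_uniform_functionals {ι κ : Type*} [Fintype ι] [Fintype κ] (U : Set V)
    (g : ι → V → V → ZMod 2) (T : ι → V → V → V → ZMod 2)
    (ℓ : V → V → κ → Module.Dual (ZMod 2) V)
    (h : ∀ u ∈ U, ∀ v ∈ U, ∀ x ∈ U, ∀ y ∈ U, ∀ z ∈ U, (∀ k, ℓ u v k x = 0) →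
      (∀ k, ℓ u v k y = 0) → (∀ k, ℓ u v k z = 0) → ∑ i, g i u v * T i x y z = 0) :
    ∃ S : Finset (Module.Dual (ZMod 2) V), S.card ≤ Fintype.card ι * Fintype.card κ ∧
      ∀ u ∈ U, ∀ v ∈ U, ∀ x ∈ U, ∀ y ∈ U, ∀ z ∈ U, (∀ f ∈ S, f x = 0) → (∀ f ∈ S, f y = 0) →
        (∀ f ∈ S, f z = 0) → ∑ i, g i u v * T i x y z = 0 := by
  classical
  let t : Set (ι → ZMod 2) := {q | ∃ u ∈ U, ∃ v ∈ U, q = fun i => g i u v}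
  obtain ⟨b, hbt, hspan, hli⟩ := exists_linearIndependent (ZMod 2) t
  have hfin : b.Finite := hli.setFinite
  have : Fintype b := hfin.fintype
  have hcard : Fintype.card b ≤ Fintype.card ι := by
    simpa using hli.fintype_card_le_finrank
  have hex : ∀ q : b, ∃ p : V × V, p.1 ∈ U ∧ p.2 ∈ U ∧ q.1 = fun i => g i p.1 p.2 := by
    rintro ⟨q, hq⟩
    obtain ⟨u, hu, v, hv, rfl⟩ := hbt hq
    exact ⟨(u, v), hu, hv, rfl⟩
  choose p hp1 hp2 hp using hex
  refine ⟨Finset.univ.image fun q : b × κ => ℓ (p q.1).1 (p q.1).2 q.2, ?_, ?_⟩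
  · refine Finset.card_image_le.trans ?_
    rw [Finset.card_univ, Fintype.card_prod]
    exact Nat.mul_le_mul_right _ hcard
  · intro u hu v hv x hx y hy z hz hSx hSy hSz
    have hmem : (fun i => g i u v) ∈ Submodule.span (ZMod 2) b := by
      rw [hspan]
      exact Submodule.subset_span ⟨u, hu, v, hv, rfl⟩
    have key : ∀ q ∈ Submodule.span (ZMod 2) b, ∑ i, q i * T i x y z = 0 := by
      intro q hq
      induction hq using Submodule.span_induction with
      | mem q hq =>
        rw [show q = _ from hp ⟨q, hq⟩]
        refine h _ (hp1 _) _ (hp2 _) x hx y hy z hz (fun k => hSx _ ?_) (fun k => hSy _ ?_)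
          (fun k => hSz _ ?_) <;>
        exact Finset.mem_image_of_mem (fun q : b × κ => ℓ (p q.1).1 (p q.1).2 q.2)
          (Finset.mem_univ (⟨q, hq⟩, k))
      | zero => simp
      | add q q' _ _ h1 h2 => simp [add_mul, Finset.sum_add_distrib, h1, h2]
      | smul c q _ h1 => simp [mul_assoc, ← Finset.mul_sum, h1]
    exact key _ hmem

/-- Linear conditions on a variable `x` expressing that `x` is annihilated by the bilinear forms
`w i` with one argument among `u, v`, and by the trilinear forms `Γ i p` with the other arguments
equal to `u, v`. -/
def mixedFunctionals {N : ℕ} (w : Fin N → V →ₗ[ZMod 2] V →ₗ[ZMod 2] ZMod 2)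
    (Γ : Fin N → Fin 10 → V →ₗ[ZMod 2] V →ₗ[ZMod 2] V →ₗ[ZMod 2] ZMod 2) (u v : V) :
    (Fin N × Fin 4) ⊕ (Fin N × Fin 10 × Fin 6) → Module.Dual (ZMod 2) V
  | .inl (i, j) => ![w i u, w i v, (w i).flip u, (w i).flip v] j
  | .inr (i, p, j) => ![Γ i p u v, Γ i p v u, (Γ i p u).flip v, (Γ i p v).flip u,
      ((Γ i p).flip u).flip v, ((Γ i p).flip v).flip u] j

lemma mixedFunctionals_eq_zero {N : ℕ} {w : Fin N → V →ₗ[ZMod 2] V →ₗ[ZMod 2] ZMod 2}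
    {Γ : Fin N → Fin 10 → V →ₗ[ZMod 2] V →ₗ[ZMod 2] V →ₗ[ZMod 2] ZMod 2} {u v x : V}
    (h : ∀ k, mixedFunctionals w Γ u v k x = 0) :
    ((∀ i, w i u x = 0) ∧ (∀ i, w i v x = 0) ∧ (∀ i, w i x u = 0) ∧ (∀ i, w i x v = 0)) ∧
    (∀ i p, Γ i p u v x = 0) ∧ (∀ i p, Γ i p v u x = 0) ∧ (∀ i p, Γ i p u x v = 0) ∧
    (∀ i p, Γ i p v x u = 0) ∧ (∀ i p, Γ i p x u v = 0) ∧ (∀ i p, Γ i p x v u = 0) :=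
  ⟨⟨fun i => h (.inl (i, 0)), fun i => h (.inl (i, 1)), fun i => h (.inl (i, 2)),
    fun i => h (.inl (i, 3))⟩, fun i p => h (.inr (i, p, 0)), fun i p => h (.inr (i, p, 1)),
    fun i p => h (.inr (i, p, 2)), fun i p => h (.inr (i, p, 3)), fun i p => h (.inr (i, p, 4)),
    fun i p => h (.inr (i, p, 5))⟩

/-- A sum of ten products of a bilinear and a trilinear form, one for each way of choosing the two
variables of the bilinear form. -/
def pairSum (w : V →ₗ[ZMod 2] V →ₗ[ZMod 2] ZMod 2)
    (Γ : Fin 10 → V →ₗ[ZMod 2] V →ₗ[ZMod 2] V →ₗ[ZMod 2] ZMod 2) (a b c d y : V) : ZMod 2 :=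
  w a b * Γ 0 c d y + w a c * Γ 1 b d y + w b c * Γ 2 a d y + w a d * Γ 3 b c y +
  w b d * Γ 4 a c y + w c d * Γ 5 a b y + w a y * Γ 6 b c d + w b y * Γ 7 a c d +
  w c y * Γ 8 a b d + w d y * Γ 9 a b c

/-- The correction term built from bilinear forms `w`, `c`, `s` and trilinear forms `Q`, `L`. -/
def correction (w c s : V →ₗ[ZMod 2] V →ₗ[ZMod 2] ZMod 2)
    (Q L : V →ₗ[ZMod 2] V →ₗ[ZMod 2] V →ₗ[ZMod 2] ZMod 2) (x₁ x₂ x₃ x₄ y : V) : ZMod 2 :=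
  c x₁ x₄ * Q x₂ x₃ y + c x₂ x₄ * Q x₁ x₃ y + c x₃ x₄ * Q x₁ x₂ y +
  s x₁ x₂ * Q x₃ x₄ y + s x₁ x₃ * Q x₂ x₄ y + s x₂ x₃ * Q x₁ x₄ y +
  w x₃ y * L x₁ x₂ x₄ + w x₂ y * L x₁ x₃ x₄ + w x₁ y * L x₂ x₃ x₄

/-- Every submodule has a linear projection onto a complement. -/
lemma exists_projection_onto_complement {E : Type*} [AddCommGroup E] [Module (ZMod 2) E]
    (W : Submodule (ZMod 2) E) :
    ∃ π : E →ₗ[ZMod 2] E, (∀ w, w - π w ∈ W) ∧ ∀ w ∈ W, π w = 0 := by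
  obtain ⟨C, hC⟩ := W.exists_isCompl
  exact ⟨C.projection _ hC.symm, fun w => Submodule.sub_projection_mem hC.symm w, fun w hw =>
    (Submodule.projection_apply_eq_zero_iff hC.symm).2 hw⟩

/-- The bilinear forms which are symmetric on `U`. -/
def symmetricOn (U : Set V) : Submodule (ZMod 2) (V →ₗ[ZMod 2] V →ₗ[ZMod 2] ZMod 2) where
  carrier := {w | ∀ u ∈ U, ∀ v ∈ U, w u v = w v u}
  add_mem' h h' u hu v hv := congrArg₂ (· + ·) (h u hu v hv) (h' u hu v hv)
  zero_mem' _ _ _ _ := rfl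
  smul_mem' c _ h u hu v hv := congrArg (c • ·) (h u hu v hv)

/-- If `A` is symmetric in its first three variables and `A + A ∘ (3 4)` is a sum of `N` products
of bilinear and trilinear forms, then on a subspace of bounded codimension a sum of boundedly many
such products can be added to `A` to make it symmetric in its first four variables. -/
theorem exists_correction {N : ℕ} (S₀ : Finset (Module.Dual (ZMod 2) V))
    (A : V → V → V → V → V → ZMod 2) (h12 : ∀ a b c d y, A a b c d y = A b a c d y)
    (h23 : ∀ a b c d y, A a b c d y = A a c b d y)
    (w : Fin N → V →ₗ[ZMod 2] V →ₗ[ZMod 2] ZMod 2)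
    (Γ : Fin N → Fin 10 → V →ₗ[ZMod 2] V →ₗ[ZMod 2] V →ₗ[ZMod 2] ZMod 2)
    (hA : ∀ a b c d y, (∀ f ∈ S₀, f a = 0) → (∀ f ∈ S₀, f b = 0) → (∀ f ∈ S₀, f c = 0) →
      (∀ f ∈ S₀, f d = 0) → (∀ f ∈ S₀, f y = 0) →
      A a b c d y + A a b d c y = ∑ i, pairSum (w i) (Γ i) a b c d y) :
    ∃ (S : Finset (Module.Dual (ZMod 2) V))
      (c s : Fin N → V →ₗ[ZMod 2] V →ₗ[ZMod 2] ZMod 2)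
      (Q L : Fin N → V →ₗ[ZMod 2] V →ₗ[ZMod 2] V →ₗ[ZMod 2] ZMod 2),
      S.card ≤ S₀.card + 1280 * N ^ 2 ∧
      ∀ x₁ x₂ x₃ x₄ y, (∀ f ∈ S, f x₁ = 0) → (∀ f ∈ S, f x₂ = 0) → (∀ f ∈ S, f x₃ = 0) →
        (∀ f ∈ S, f x₄ = 0) → (∀ f ∈ S, f y = 0) →
        (∑ i, correction (w i) (c i) (s i) (Q i) (L i) x₁ x₂ x₃ x₄ y =
          ∑ i, correction (w i) (c i) (s i) (Q i) (L i) x₂ x₁ x₃ x₄ y) ∧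
        (∑ i, correction (w i) (c i) (s i) (Q i) (L i) x₁ x₂ x₃ x₄ y =
          ∑ i, correction (w i) (c i) (s i) (Q i) (L i) x₁ x₃ x₂ x₄ y) ∧
        A x₁ x₂ x₃ x₄ y + ∑ i, correction (w i) (c i) (s i) (Q i) (L i) x₁ x₂ x₃ x₄ y =
          A x₁ x₂ x₄ x₃ y + ∑ i, correction (w i) (c i) (s i) (Q i) (L i) x₁ x₂ x₄ x₃ y := by
  classical
  let U : Set V := {x | ∀ f ∈ S₀, f x = 0}
  obtain ⟨π, hsymm, hπ⟩ := exists_projection_onto_complement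
    (E := V →ₗ[ZMod 2] V →ₗ[ZMod 2] ZMod 2) (symmetricOn U)
  have swap12 : ∀ a ∈ U, ∀ b ∈ U, ∀ c ∈ U, ∀ d ∈ U, ∀ y ∈ U,
      ∑ i, (pairSum (w i) (Γ i) a b c d y + pairSum (w i) (Γ i) b a c d y) = 0 := by
    intro a ha b hb c hc d hd y hy
    rw [Finset.sum_add_distrib, ← hA a b c d y ha hb hc hd hy, ← hA b a c d y hb ha hc hd hy,
      h12 a b c d y, h12 a b d c y, CharTwo.add_self_eq_zero]
  have swap34 : ∀ a ∈ U, ∀ b ∈ U, ∀ c ∈ U, ∀ d ∈ U, ∀ y ∈ U,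
      ∑ i, (pairSum (w i) (Γ i) a b c d y + pairSum (w i) (Γ i) a b d c y) = 0 := by
    intro a ha b hb c hc d hd y hy
    rw [Finset.sum_add_distrib, ← hA a b c d y ha hb hc hd hy, ← hA a b d c y ha hb hd hc hy,
      add_comm (A a b d c y), CharTwo.add_self_eq_zero]
  have cocycle : ∀ a ∈ U, ∀ b ∈ U, ∀ c ∈ U, ∀ d ∈ U, ∀ y ∈ U,
      ∑ i, (pairSum (w i) (Γ i) a b c d y + pairSum (w i) (Γ i) b c a d y +
        pairSum (w i) (Γ i) b d a c y) = 0 := by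
    intro a ha b hb c hc d hd y hy
    rw [Finset.sum_add_distrib, Finset.sum_add_distrib, ← hA a b c d y ha hb hc hd hy,
      ← hA b c a d y hb hc ha hd hy, ← hA b d a c y hb hd ha hc hy, h23 b c a d y,
      h12 b a c d y, h23 b d a c y, h12 b a d c y, h23 b d c a y]
    linear_combination (A a b c d y + A a b d c y + A b c d a y) *
      (CharTwo.two_eq_zero : (2 : ZMod 2) = 0)
  have peel : ∀ T T' : Fin N → V → V → V → ZMod 2,
      (∀ u ∈ U, ∀ v ∈ U, ∀ x ∈ U, ∀ y ∈ U, ∀ z ∈ U,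
        (∀ k, mixedFunctionals w Γ u v k x = 0) → (∀ k, mixedFunctionals w Γ u v k y = 0) →
        (∀ k, mixedFunctionals w Γ u v k z = 0) →
        ∑ i, (w i u v * T i x y z + w i v u * T' i x y z) = 0) →
      ∃ S : Finset (Module.Dual (ZMod 2) V), S.card ≤ 128 * N ^ 2 ∧
        ∀ u ∈ U, ∀ v ∈ U, ∀ x ∈ U, ∀ y ∈ U, ∀ z ∈ U, (∀ f ∈ S, f x = 0) → (∀ f ∈ S, f y = 0) →
          (∀ f ∈ S, f z = 0) → ∑ i, (w i u v * T i x y z + w i v u * T' i x y z) = 0 := by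
    intro T T' h
    obtain ⟨S, hS, hS'⟩ := exists_uniform_functionals U
      (Sum.elim (fun i u v => w i u v) (fun i u v => w i v u)) (Sum.elim T T')
      (mixedFunctionals w Γ)
      (by simpa only [Fintype.sum_sum_type, Sum.elim_inl, Sum.elim_inr, Finset.sum_add_distrib]
        using h)
    refine ⟨S, hS.trans (le_of_eq ?_), ?_⟩
    · simp only [Fintype.card_sum, Fintype.card_prod, Fintype.card_fin]
      ring
    · simpa only [Fintype.sum_sum_type, Sum.elim_inl, Sum.elim_inr, Finset.sum_add_distrib]
        using hS'
  obtain ⟨S1, hS1, R1⟩ := peel (fun i x y z => Γ i 1 x y z + Γ i 2 x y z) (fun _ _ _ _ => 0) (by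
    intro u hu v hv x hx y hy z hz kx ky kz
    refine (Finset.sum_congr rfl fun i _ => ?_).trans (swap12 u hu x hx v hv y hy z hz)
    simp only [pairSum, mixedFunctionals_eq_zero kx, mixedFunctionals_eq_zero ky,
      mixedFunctionals_eq_zero kz, mul_zero, zero_mul, add_zero, zero_add]
    ring)
  obtain ⟨S2, hS2, R2⟩ := peel (fun i x y z => Γ i 3 x y z + Γ i 4 x y z) (fun _ _ _ _ => 0) (by
    intro u hu v hv x hx y hy z hz kx ky kz
    refine (Finset.sum_congr rfl fun i _ => ?_).trans (swap12 u hu x hx y hy v hv z hz)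
    simp only [pairSum, mixedFunctionals_eq_zero kx, mixedFunctionals_eq_zero ky,
      mixedFunctionals_eq_zero kz, mul_zero, zero_mul, add_zero, zero_add]
    ring)
  obtain ⟨S3, hS3, R3⟩ := peel (fun i x y z => Γ i 1 x y z + Γ i 3 x y z) (fun _ _ _ _ => 0) (by
    intro u hu v hv x hx y hy z hz kx ky kz
    refine (Finset.sum_congr rfl fun i _ => ?_).trans (swap34 u hu x hx v hv y hy z hz)
    simp only [pairSum, mixedFunctionals_eq_zero kx, mixedFunctionals_eq_zero ky,
      mixedFunctionals_eq_zero kz, mul_zero, zero_mul, add_zero, zero_add]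
    ring)
  obtain ⟨S4, hS4, R4⟩ := peel (fun i x y z => Γ i 8 x y z + Γ i 9 x y z) (fun _ _ _ _ => 0) (by
    intro u hu v hv x hx y hy z hz kx ky kz
    refine (Finset.sum_congr rfl fun i _ => ?_).trans (swap34 x hx y hy u hu z hz v hv)
    simp only [pairSum, mixedFunctionals_eq_zero kx, mixedFunctionals_eq_zero ky,
      mixedFunctionals_eq_zero kz, mul_zero, zero_mul, add_zero, zero_add]
    ring)
  obtain ⟨S5, hS5, R5⟩ := peel (fun i x y z => Γ i 8 x y z + Γ i 8 y x z) (fun _ _ _ _ => 0) (by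
    intro u hu v hv x hx y hy z hz kx ky kz
    refine (Finset.sum_congr rfl fun i _ => ?_).trans (swap12 x hx y hy u hu z hz v hv)
    simp only [pairSum, mixedFunctionals_eq_zero kx, mixedFunctionals_eq_zero ky,
      mixedFunctionals_eq_zero kz, mul_zero, zero_mul, add_zero, zero_add]
    ring)
  obtain ⟨S6, hS6, R6⟩ := peel (fun i x y z => Γ i 6 x y z + Γ i 7 x y z) (fun _ _ _ _ => 0) (by
    intro u hu v hv x hx y hy z hz kx ky kz
    refine (Finset.sum_congr rfl fun i _ => ?_).trans (swap12 u hu x hx y hy z hz v hv)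
    simp only [pairSum, mixedFunctionals_eq_zero kx, mixedFunctionals_eq_zero ky,
      mixedFunctionals_eq_zero kz, mul_zero, zero_mul, add_zero, zero_add]
    ring)
  obtain ⟨S7, hS7, R7⟩ := peel (fun i x y z => Γ i 0 x y z)
      (fun i x y z => Γ i 1 x y z + Γ i 1 y x z) (by
    intro u hu v hv x hx y hy z hz kx ky kz
    refine (Finset.sum_congr rfl fun i _ => ?_).trans (cocycle u hu v hv x hx y hy z hz)
    simp only [pairSum, mixedFunctionals_eq_zero kx, mixedFunctionals_eq_zero ky,
      mixedFunctionals_eq_zero kz, mul_zero, zero_mul, add_zero, zero_add]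
    ring)
  obtain ⟨S8, hS8, R8⟩ := peel (fun i x y z => Γ i 1 x y z + Γ i 5 x y z)
      (fun i x y z => Γ i 2 x y z) (by
    intro u hu v hv x hx y hy z hz kx ky kz
    refine (Finset.sum_congr rfl fun i _ => ?_).trans (cocycle u hu x hx v hv y hy z hz)
    simp only [pairSum, mixedFunctionals_eq_zero kx, mixedFunctionals_eq_zero ky,
      mixedFunctionals_eq_zero kz, mul_zero, zero_mul, add_zero, zero_add]
    ring)
  obtain ⟨S9, hS9, R9⟩ := peel (fun i x y z => Γ i 5 x y z + Γ i 5 y x z) (fun _ _ _ _ => 0) (by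
    intro u hu v hv x hx y hy z hz kx ky kz
    refine (Finset.sum_congr rfl fun i _ => ?_).trans (swap12 x hx y hy u hu v hv z hz)
    simp only [pairSum, mixedFunctionals_eq_zero kx, mixedFunctionals_eq_zero ky,
      mixedFunctionals_eq_zero kz, mul_zero, zero_mul, add_zero, zero_add]
    ring)
  obtain ⟨S10, hS10, R10⟩ := peel (fun i x y z => Γ i 8 x y z + Γ i 7 y x z + Γ i 9 y z x)
      (fun _ _ _ _ => 0) (by
    intro u hu v hv x hx y hy z hz kx ky kz
    refine (Finset.sum_congr rfl fun i _ => ?_).trans (cocycle x hx y hy u hu z hz v hv)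
    simp only [pairSum, mixedFunctionals_eq_zero kx, mixedFunctionals_eq_zero ky,
      mixedFunctionals_eq_zero kz, mul_zero, zero_mul, add_zero, zero_add]
    ring)
  refine ⟨S₀ ∪ S1 ∪ S2 ∪ S3 ∪ S4 ∪ S5 ∪ S6 ∪ S7 ∪ S8 ∪ S9 ∪ S10, fun i => π (w i),
    fun i => w i - π (w i), fun i => Γ i 1, fun i => Γ i 8, ?_, ?_⟩
  · have hcard : ∀ {S T : Finset (Module.Dual (ZMod 2) V)} {a b : ℕ}, S.card ≤ a → T.card ≤ b →
        (S ∪ T).card ≤ a + b := fun h h' => (Finset.card_union_le _ _).trans (add_le_add h h')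
    refine (hcard (hcard (hcard (hcard (hcard (hcard (hcard (hcard (hcard (hcard le_rfl hS1) hS2)
      hS3) hS4) hS5) hS6) hS7) hS8) hS9) hS10).trans (le_of_eq ?_)
    ring
  let S := S₀ ∪ S1 ∪ S2 ∪ S3 ∪ S4 ∪ S5 ∪ S6 ∪ S7 ∪ S8 ∪ S9 ∪ S10
  let Z : Set V := {x | ∀ f ∈ S, f x = 0}
  have hZU : Z ⊆ U := fun x hx f hf => hx f (by simp [S, hf])
  have restrict : ∀ {T : Finset (Module.Dual (ZMod 2) V)} {F : V → V → V → V → V → ZMod 2}, T ⊆ S →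
      (∀ u ∈ U, ∀ v ∈ U, ∀ x ∈ U, ∀ y ∈ U, ∀ z ∈ U, (∀ f ∈ T, f x = 0) → (∀ f ∈ T, f y = 0) →
        (∀ f ∈ T, f z = 0) → F u v x y z = 0) →
      ∀ u ∈ U, ∀ v ∈ U, ∀ x ∈ Z, ∀ y ∈ Z, ∀ z ∈ Z, F u v x y z = 0 :=
    fun hT h u hu v hv x hx y hy z hz => h u hu v hv x (hZU hx) y (hZU hy) z (hZU hz)
      (fun f hf => hx f (hT hf)) (fun f hf => hy f (hT hf)) (fun f hf => hz f (hT hf))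
  replace R1 := restrict (by intro f hf; simp [S, hf]) R1
  replace R2 := restrict (by intro f hf; simp [S, hf]) R2
  replace R3 := restrict (by intro f hf; simp [S, hf]) R3
  replace R4 := restrict (by intro f hf; simp [S, hf]) R4
  replace R5 := restrict (by intro f hf; simp [S, hf]) R5
  replace R6 := restrict (by intro f hf; simp [S, hf]) R6
  replace R7 := restrict (by intro f hf; simp [S, hf]) R7
  replace R8 := restrict (by intro f hf; simp [S, hf]) R8
  replace R9 := restrict (by intro f hf; simp [S, hf]) R9
  replace R10 := restrict (by intro f hf; simp [S, hf]) R10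
  let X : Fin 10 → V → V → V → V → V → ZMod 2 :=
    fun p u v x y z => ∑ i, w i u v * Γ i p x y z
  let C : V → V → V → V → V → ZMod 2 := fun u v x y z => ∑ i, π (w i) u v * Γ i 1 x y z
  let D : V → V → V → V → V → ZMod 2 :=
    fun u v x y z => ∑ i, (w i - π (w i)) u v * Γ i 1 x y z
  have two : (2 : ZMod 2) = 0 := CharTwo.two_eq_zero
  replace R1 : ∀ u ∈ U, ∀ v ∈ U, ∀ x ∈ Z, ∀ y ∈ Z, ∀ z ∈ Z, X 1 u v x y z = X 2 u v x y z := by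
    intro u hu v hv x hx y hy z hz
    have h := R1 u hu v hv x hx y hy z hz
    simp only [mul_add, Finset.sum_add_distrib, mul_zero, add_zero] at h
    linear_combination h - (X 2 u v x y z) * two
  replace R2 : ∀ u ∈ U, ∀ v ∈ U, ∀ x ∈ Z, ∀ y ∈ Z, ∀ z ∈ Z, X 3 u v x y z = X 4 u v x y z := by
    intro u hu v hv x hx y hy z hz
    have h := R2 u hu v hv x hx y hy z hz
    simp only [mul_add, Finset.sum_add_distrib, mul_zero, add_zero] at h
    linear_combination h - (X 4 u v x y z) * two
  replace R3 : ∀ u ∈ U, ∀ v ∈ U, ∀ x ∈ Z, ∀ y ∈ Z, ∀ z ∈ Z, X 1 u v x y z = X 3 u v x y z := by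
    intro u hu v hv x hx y hy z hz
    have h := R3 u hu v hv x hx y hy z hz
    simp only [mul_add, Finset.sum_add_distrib, mul_zero, add_zero] at h
    linear_combination h - (X 3 u v x y z) * two
  replace R4 : ∀ u ∈ U, ∀ v ∈ U, ∀ x ∈ Z, ∀ y ∈ Z, ∀ z ∈ Z, X 8 u v x y z = X 9 u v x y z := by
    intro u hu v hv x hx y hy z hz
    have h := R4 u hu v hv x hx y hy z hz
    simp only [mul_add, Finset.sum_add_distrib, mul_zero, add_zero] at h
    linear_combination h - (X 9 u v x y z) * two
  replace R5 : ∀ u ∈ U, ∀ v ∈ U, ∀ x ∈ Z, ∀ y ∈ Z, ∀ z ∈ Z, X 8 u v x y z = X 8 u v y x z := by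
    intro u hu v hv x hx y hy z hz
    have h := R5 u hu v hv x hx y hy z hz
    simp only [mul_add, Finset.sum_add_distrib, mul_zero, add_zero] at h
    linear_combination h - (X 8 u v y x z) * two
  replace R6 : ∀ u ∈ U, ∀ v ∈ U, ∀ x ∈ Z, ∀ y ∈ Z, ∀ z ∈ Z, X 6 u v x y z = X 7 u v x y z := by
    intro u hu v hv x hx y hy z hz
    have h := R6 u hu v hv x hx y hy z hz
    simp only [mul_add, Finset.sum_add_distrib, mul_zero, add_zero] at h
    linear_combination h - (X 7 u v x y z) * two
  replace R7 : ∀ u ∈ U, ∀ v ∈ U, ∀ x ∈ Z, ∀ y ∈ Z, ∀ z ∈ Z,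
      X 0 u v x y z = X 1 v u x y z + X 1 v u y x z := by
    intro u hu v hv x hx y hy z hz
    have h := R7 u hu v hv x hx y hy z hz
    simp only [mul_add, Finset.sum_add_distrib] at h
    linear_combination h - (X 1 v u x y z + X 1 v u y x z) * two
  replace R8 : ∀ u ∈ U, ∀ v ∈ U, ∀ x ∈ Z, ∀ y ∈ Z, ∀ z ∈ Z,
      X 5 u v x y z = X 1 u v x y z + X 2 v u x y z := by
    intro u hu v hv x hx y hy z hz
    have h := R8 u hu v hv x hx y hy z hz
    simp only [mul_add, Finset.sum_add_distrib] at h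
    linear_combination h - (X 1 u v x y z + X 2 v u x y z) * two
  replace R9 : ∀ u ∈ U, ∀ v ∈ U, ∀ x ∈ Z, ∀ y ∈ Z, ∀ z ∈ Z, X 5 u v x y z = X 5 u v y x z := by
    intro u hu v hv x hx y hy z hz
    have h := R9 u hu v hv x hx y hy z hz
    simp only [mul_add, Finset.sum_add_distrib, mul_zero, add_zero] at h
    linear_combination h - (X 5 u v y x z) * two
  replace R10 : ∀ u ∈ U, ∀ v ∈ U, ∀ x ∈ Z, ∀ y ∈ Z, ∀ z ∈ Z,
      X 8 u v x y z = X 7 u v y x z + X 9 u v y z x := by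
    intro u hu v hv x hx y hy z hz
    have h := R10 u hu v hv x hx y hy z hz
    simp only [mul_add, Finset.sum_add_distrib, mul_zero, add_zero] at h
    linear_combination h - (X 7 u v y x z + X 9 u v y z x) * two
  have hD : ∀ u ∈ U, ∀ v ∈ U, ∀ x y z, D u v x y z = D v u x y z := fun u hu v hv x y z =>
    Finset.sum_congr rfl fun i _ => by rw [hsymm (w i) u hu v hv]
  have hX : ∀ u v x y z, X 1 u v x y z = C u v x y z + D u v x y z := fun u v x y z => by
    simp only [X, C, D, ← Finset.sum_add_distrib, LinearMap.sub_apply]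
    exact Finset.sum_congr rfl fun i _ => by ring
  have hφ : ∀ a b c d y, ∑ i, pairSum (w i) (Γ i) a b c d y =
      X 0 a b c d y + X 1 a c b d y + X 2 b c a d y + X 3 a d b c y + X 4 b d a c y +
      X 5 c d a b y + X 6 a y b c d + X 7 b y a c d + X 8 c y a b d + X 9 d y a b c := by
    intro a b c d y
    simp only [pairSum, Finset.sum_add_distrib, X]
  have hψ : ∀ a b c d y,
      ∑ i, correction (w i) (π (w i)) (w i - π (w i)) (Γ i 1) (Γ i 8) a b c d y =
        C a d b c y + C b d a c y + C c d a b y + D a b c d y + D a c b d y + D b c a d y +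
        X 8 c y a b d + X 8 b y a c d + X 8 a y b c d := by
    intro a b c d y
    simp only [correction, Finset.sum_add_distrib, X, C, D]
  have hC : ∀ u v, ∀ x ∈ Z, ∀ y ∈ Z, ∀ z ∈ Z, C u v x y z = C u v y x z := by
    intro u v x hx y hy z hz
    have hq : ∑ i, (Γ i 1 x y z + Γ i 1 y x z) • w i ∈ symmetricOn U := by
      intro u hu v hv
      have e : ∀ u v, (∑ i, (Γ i 1 x y z + Γ i 1 y x z) • w i) u v =
          X 1 u v x y z + X 1 u v y x z := fun u v => by
        simp only [X, ← Finset.sum_add_distrib, LinearMap.sum_apply, LinearMap.smul_apply,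
          smul_eq_mul]
        exact Finset.sum_congr rfl fun i _ => by ring
      rw [e, e]
      linear_combination (norm := (ring_nf; simp only [two, mul_zero, add_zero, sub_zero]))
        R8 u hu v hv x hx y hy z hz + R8 u hu v hv y hy x hx z hz + R1 v hv u hu x hx y hy z hz +
          R1 v hv u hu y hy x hx z hz + R9 u hu v hv x hx y hy z hz
    have hq' := hπ _ hq
    have e : C u v x y z + C u v y x z = 0 := by
      refine Eq.trans ?_ (LinearMap.congr_fun₂ hq' u v)
      simp only [C, ← Finset.sum_add_distrib, map_sum, map_smul, LinearMap.sum_apply,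
        LinearMap.smul_apply, smul_eq_mul]
      exact Finset.sum_congr rfl fun i _ => by ring
    exact CharTwo.add_eq_zero.1 e
  intro a b c d y ha hb hc hd hy
  have hA' := hA a b c d y (hZU ha) (hZU hb) (hZU hc) (hZU hd) (hZU hy)
  rw [hφ] at hA'
  rw [hψ, hψ, hψ, hψ]
  refine ⟨?_, ?_, ?_⟩
  · linear_combination hC c d a ha b hb y hy + hD a (hZU ha) b (hZU hb) c d y +
        R5 c (hZU hc) y (hZU hy) a ha b hb d hd
  · linear_combination hC a d b hb c hc y hy + hD b (hZU hb) c (hZU hc) a d y +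
        R5 a (hZU ha) y (hZU hy) b hb c hc d hd
  · linear_combination (norm := (ring_nf; simp only [two, mul_zero, add_zero, sub_zero]))
      hA' + R7 a (hZU ha) b (hZU hb) c hc d hd y hy + R1 b (hZU hb) c (hZU hc) a ha d hd y hy +
      R3 a (hZU ha) d (hZU hd) b hb c hc y hy + R3 b (hZU hb) d (hZU hd) a ha c hc y hy +
      R2 b (hZU hb) d (hZU hd) a ha c hc y hy +
      R8 c (hZU hc) d (hZU hd) a ha b hb y hy + R1 d (hZU hd) c (hZU hc) a ha b hb y hy +
      R6 a (hZU ha) y (hZU hy) b hb c hc d hd + R10 a (hZU ha) y (hZU hy) c hc b hb d hd +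
      R10 b (hZU hb) y (hZU hy) c hc a ha d hd + R4 d (hZU hd) y (hZU hy) a ha b hb c hc +
      R4 a (hZU ha) y (hZU hy) b hb d hd c hc + R4 b (hZU hb) y (hZU hy) a ha d hd c hc +
      R5 a (hZU ha) y (hZU hy) b hb c hc d hd + R5 b (hZU hb) y (hZU hy) a ha c hc d hd +
      hX a c b d y + hX b c a d y + hX a d b c y + hX b d a c y + hX c d a b y + hX d c a b y +
      hX b a c d y + hX b a d c y + hC b a c hc d hd y hy + hD c (hZU hc) d (hZU hd) a b y +
      hD a (hZU ha) b (hZU hb) c d y + hD a (hZU ha) b (hZU hb) d c y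

end Core

section Retraction

variable {V : Type*} [AddCommGroup V] [Module (ZMod 2) V]

/-- A linear map into the common kernel of `S` which differs from the identity by an operator
of rank at most `S.card`. -/
lemma exists_map_into_kernel (S : Finset (Module.Dual (ZMod 2) V)) :
    ∃ m ≤ S.card, ∃ (P : V →ₗ[ZMod 2] V) (ℓ : Fin m → Module.Dual (ZMod 2) V) (v : Fin m → V),
      (∀ x, ∀ f ∈ S, f (P x) = 0) ∧ ∀ x, x = P x + ∑ j, ℓ j x • v j := by
  classical
  induction S using Finset.induction_on with
  | empty => exact ⟨0, le_rfl, LinearMap.id, Fin.elim0, Fin.elim0, by simp, by simp⟩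
  | insert f S hf ih =>
    obtain ⟨m, hm, P, ℓ, v, hP, hx⟩ := ih
    rw [Finset.card_insert_of_notMem hf]
    by_cases h : ∀ x, f (P x) = 0
    · refine ⟨m, by omega, P, ℓ, v, fun x g hg => ?_, hx⟩
      obtain rfl | hg := Finset.mem_insert.1 hg
      exacts [h x, hP x g hg]
    · obtain ⟨v₀, hv₀⟩ := not_forall.1 h
      have hv₁ : f (P v₀) = 1 := Fin.eq_one_of_ne_zero _ hv₀
      refine ⟨m + 1, by omega, P - (f.comp P).smulRight (P v₀), Fin.cons (f.comp P) ℓ,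
        Fin.cons (P v₀) v, fun x g hg => ?_, fun x => ?_⟩
      · obtain rfl | hg := Finset.mem_insert.1 hg
        · simp [hv₁]
        · simp [hP _ g hg]
      · rw [Fin.sum_univ_succ]
        simp only [Fin.cons_zero, Fin.cons_succ, LinearMap.sub_apply, LinearMap.smulRight_apply,
          LinearMap.comp_apply]
        rw [← add_assoc, sub_add_cancel]
        exact hx x

end Retraction

section Decompositions

variable {V : Type*} [AddCommGroup V] [Module (ZMod 2) V] {k : ℕ}

/-- The linear form obtained by fixing all variables but one. -/
def MultilinearOn.slice {S : Finset (Fin k)} {β : (Fin k → V) → ZMod 2}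
    (h : MultilinearOn k S β) {i : Fin k} (hi : i ∈ S) (x : Fin k → V) : V →ₗ[ZMod 2] ZMod 2 :=
  (AddMonoidHom.mk' (fun u => β (Function.update x i u)) (h.2 i hi x)).toZModLinearMap 2

lemma MultilinearOn.slice_apply {S : Finset (Fin k)} {β : (Fin k → V) → ZMod 2}
    (h : MultilinearOn k S β) {i : Fin k} (hi : i ∈ S) (x : Fin k → V) (u : V) :
    h.slice hi x u = β (Function.update x i u) := rfl

lemma MultilinearOn.add {S : Finset (Fin k)} {β γ : (Fin k → V) → ZMod 2}
    (hβ : MultilinearOn k S β) (hγ : MultilinearOn k S γ) :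
    MultilinearOn k S (fun x => β x + γ x) :=
  ⟨fun x y h => congrArg₂ _ (hβ.1 x y h) (hγ.1 x y h), fun i hi x u v => by
    beta_reduce
    rw [hβ.2 i hi, hγ.2 i hi, add_add_add_comm]⟩

lemma MultilinearOn.sum {S : Finset (Fin k)} {ι : Type*} (s : Finset ι)
    {β : ι → (Fin k → V) → ZMod 2} (hβ : ∀ i, MultilinearOn k S (β i)) :
    MultilinearOn k S (fun x => ∑ i ∈ s, β i x) :=
  ⟨fun x y h => Finset.sum_congr rfl fun i _ => (hβ i).1 x y h, fun i hi x u v => by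
    rw [← Finset.sum_add_distrib]
    exact Finset.sum_congr rfl fun j _ => (hβ j).2 i hi x u v⟩

lemma MultilinearOn.mul {S I : Finset (Fin k)} {β γ : (Fin k → V) → ZMod 2} (hI : I ⊆ S)
    (hβ : MultilinearOn k I β) (hγ : MultilinearOn k (S \ I) γ) :
    MultilinearOn k S (fun x => β x * γ x) := by
  refine ⟨fun x y h => ?_, fun i hi x u v => ?_⟩
  · exact congrArg₂ _ (hβ.1 x y fun i hi => h i (hI hi))
      (hγ.1 x y fun i hi => h i (Finset.sdiff_subset hi))
  · have const : ∀ {J : Finset (Fin k)} {δ : (Fin k → V) → ZMod 2}, MultilinearOn k J δ → i ∉ J →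
        ∀ u, δ (Function.update x i u) = δ x := fun hδ hiJ u =>
      hδ.1 _ _ fun j hj => Function.update_of_ne (ne_of_mem_of_not_mem hj hiJ) _ _
    beta_reduce
    by_cases hiI : i ∈ I
    · have hiJ : i ∉ S \ I := fun h => (Finset.mem_sdiff.1 h).2 hiI
      rw [hβ.2 i hiI, const hγ hiJ, const hγ hiJ, const hγ hiJ, add_mul]
    · rw [hγ.2 i (Finset.mem_sdiff.2 ⟨hi, hiI⟩), const hβ hiI, const hβ hiI, const hβ hiI, mul_add]

lemma MultilinearOn.comp {S : Finset (Fin k)} {β : (Fin k → V) → ZMod 2}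
    (hβ : MultilinearOn k S β) (P : Fin k → V →ₗ[ZMod 2] V) :
    MultilinearOn k S (fun x => β fun i => P i (x i)) := by
  refine ⟨fun x y h => hβ.1 _ _ fun i hi => by rw [h i hi], fun i hi x u v => ?_⟩
  simp only [Function.apply_update fun i => P i, map_add]
  exact hβ.2 i hi _ _ _

lemma MultilinearOn.update {S : Finset (Fin k)} {β : (Fin k → V) → ZMod 2}
    (hβ : MultilinearOn k S β) (i : Fin k) (v : V) :
    MultilinearOn k (S \ {i}) (fun x => β (Function.update x i v)) := by
  refine ⟨fun x y h => hβ.1 _ _ fun j hj => ?_, fun j hj x u u' => ?_⟩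
  · by_cases hji : j = i
    · subst hji
      simp
    · simpa [hji] using h j (by simp [hj, hji])
  · obtain ⟨hj, hji⟩ := Finset.mem_sdiff.1 hj
    have hji : j ≠ i := by simpa using hji
    simp only [Function.update_comm hji]
    exact hβ.2 j hj _ _ _

lemma multilinearOn_linear (ℓ : V →ₗ[ZMod 2] ZMod 2) (i : Fin k) :
    MultilinearOn k {i} (fun x => ℓ (x i)) :=
  ⟨fun x y h => congrArg ℓ (h i (by simp)), fun j hj x u v => by
    obtain rfl := Finset.mem_singleton.1 hj
    simp⟩

lemma multilinearOn_bilinear (w : V →ₗ[ZMod 2] V →ₗ[ZMod 2] ZMod 2) {i j : Fin k} (hij : i ≠ j) :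
    MultilinearOn k {i, j} (fun x => w (x i) (x j)) := by
  refine ⟨fun x y h => by simp [h i, h j], fun p hp x u v => ?_⟩
  simp only [Finset.mem_insert, Finset.mem_singleton] at hp
  obtain rfl | rfl := hp <;> simp [hij, hij.symm]

lemma multilinearOn_trilinear (T : V →ₗ[ZMod 2] V →ₗ[ZMod 2] V →ₗ[ZMod 2] ZMod 2)
    {i j l : Fin k} (hij : i ≠ j) (hil : i ≠ l) (hjl : j ≠ l) :
    MultilinearOn k {i, j, l} (fun x => T (x i) (x j) (x l)) := by
  refine ⟨fun x y h => by simp [h i, h j, h l], fun p hp x u v => ?_⟩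
  simp only [Finset.mem_insert, Finset.mem_singleton] at hp
  obtain rfl | rfl | rfl := hp <;> simp [hij, hij.symm, hil, hil.symm, hjl, hjl.symm]

lemma MultilinearOn.exists_linear {i : Fin k} {β : (Fin k → V) → ZMod 2}
    (h : MultilinearOn k {i} β) : ∃ ℓ : V →ₗ[ZMod 2] ZMod 2, ∀ x, β x = ℓ (x i) :=
  ⟨h.slice (mem_singleton_self i) 0, fun x => h.1 _ _ (by simp)⟩

lemma MultilinearOn.exists_bilinear {i j : Fin k} (hij : i ≠ j) {β : (Fin k → V) → ZMod 2}
    (h : MultilinearOn k {i, j} β) :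
    ∃ w : V →ₗ[ZMod 2] V →ₗ[ZMod 2] ZMod 2, ∀ x, β x = w (x i) (x j) := by
  refine ⟨(AddMonoidHom.mk' (fun u => h.slice (i := j) (by simp) (Function.update 0 i u))
    fun u v => ?_).toZModLinearMap 2, fun x => h.1 _ _ ?_⟩
  · ext y
    simp only [LinearMap.add_apply, MultilinearOn.slice_apply, Function.update_comm hij]
    exact h.2 i (by simp) _ _ _
  · simp [hij]

lemma MultilinearOn.exists_trilinear {i j l : Fin k} (hij : i ≠ j) (hil : i ≠ l) (hjl : j ≠ l)
    {β : (Fin k → V) → ZMod 2} (h : MultilinearOn k {i, j, l} β) :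
    ∃ T : V →ₗ[ZMod 2] V →ₗ[ZMod 2] V →ₗ[ZMod 2] ZMod 2, ∀ x, β x = T (x i) (x j) (x l) := by
  have hS : ∀ u, MultilinearOn k {j, l} (fun x => β (Function.update x i u)) := fun u => by
    convert h.update i u using 1
    ext p
    simp only [Finset.mem_insert, Finset.mem_singleton, Finset.mem_sdiff]
    grind
  choose w hw using fun u => (hS u).exists_bilinear hjl
  have hw' : ∀ u v y, w u v y =
      β (Function.update (Function.update (Function.update 0 l y) j v) i u) := fun u v y => by
    rw [hw]
    simp [hjl.symm]
  refine ⟨(AddMonoidHom.mk' w fun u u' => ?_).toZModLinearMap 2, fun x => ?_⟩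
  · ext v y
    simp only [LinearMap.add_apply, hw']
    exact h.2 i (by simp) _ _ _
  · exact (congrArg β (Function.update_eq_self i x)).symm.trans (hw (x i) x)

lemma PrankDecompOn.zero (S : Finset (Fin k)) :
    PrankDecompOn k S 0 (fun _ : Fin k → V => 0) :=
  ⟨Fin.elim0, Fin.elim0, Fin.elim0, fun i => i.elim0, fun i => i.elim0, fun i => i.elim0,
    fun i => i.elim0, fun i => i.elim0, fun _ => rfl⟩

lemma PrankDecompOn.add {S : Finset (Fin k)} {m m' : ℕ} {α α' : (Fin k → V) → ZMod 2}
    (h : PrankDecompOn k S m α) (h' : PrankDecompOn k S m' α') :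
    PrankDecompOn k S (m + m') (fun x => α x + α' x) := by
  obtain ⟨I, β, γ, h1, h2, h3, h4, h5, h6⟩ := h
  obtain ⟨I', β', γ', h1', h2', h3', h4', h5', h6'⟩ := h'
  refine ⟨Fin.append I I', Fin.append β β', Fin.append γ γ', ?_, ?_, ?_, ?_, ?_, fun x => ?_⟩
  on_goal 6 => simp [Fin.sum_univ_add, h6, h6']
  all_goals
    intro i
    refine Fin.addCases (fun i => ?_) (fun i => ?_) i <;>
      simp only [Fin.append_left, Fin.append_right]
    solve_by_elim
    solve_by_elim

lemma PrankDecompOn.sum {S : Finset (Fin k)} {m n : ℕ} {α : Fin n → (Fin k → V) → ZMod 2}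
    (h : ∀ i, PrankDecompOn k S m (α i)) :
    PrankDecompOn k S (n * m) (fun x => ∑ i, α i x) := by
  induction n with
  | zero => simpa using PrankDecompOn.zero S
  | succ n ih =>
    simp only [Fin.sum_univ_castSucc, Nat.succ_mul]
    exact (ih fun i => h i.castSucc).add (h (Fin.last n))

lemma PrankDecompOn.mul {S I : Finset (Fin k)} {β γ : (Fin k → V) → ZMod 2} (hI : I ⊆ S)
    (h0 : I ≠ ∅) (hS : I ≠ S) (hβ : MultilinearOn k I β) (hγ : MultilinearOn k (S \ I) γ) :
    PrankDecompOn k S 1 (fun x => β x * γ x) :=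
  ⟨fun _ => I, fun _ => β, fun _ => γ, fun _ => hI, fun _ => h0, fun _ => hS, fun _ => hβ,
    fun _ => hγ, fun x => by simp⟩

lemma PrankDecompOn.comp {S : Finset (Fin k)} {m : ℕ} {α : (Fin k → V) → ZMod 2}
    (h : PrankDecompOn k S m α) (P : Fin k → V →ₗ[ZMod 2] V) :
    PrankDecompOn k S m (fun x => α fun i => P i (x i)) := by
  obtain ⟨I, β, γ, h1, h2, h3, h4, h5, h6⟩ := h
  exact ⟨I, _, _, h1, h2, h3, fun i => (h4 i).comp P, fun i => (h5 i).comp P, fun x => h6 _⟩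

lemma PrankDecompOn.multilinearOn {S : Finset (Fin k)} {m : ℕ} {α : (Fin k → V) → ZMod 2}
    (h : PrankDecompOn k S m α) : MultilinearOn k S α := by
  obtain ⟨I, β, γ, h1, h2, h3, h4, h5, h6⟩ := h
  rw [show α = fun x => ∑ i, β i x * γ i x from funext h6]
  exact MultilinearOn.sum _ fun i => (h4 i).mul (h1 i) (h5 i)

/-- Replacing each variable of a multilinear form by its image under a map differing from the
identity by an operator of rank at most `m` changes the form by one of partition rank at most
`k * m`. -/
lemma IsMultilinear.prankDecompOn_add_comp (hk : 2 ≤ k) {α : (Fin k → V) → ZMod 2}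
    (hα : IsMultilinear k α) {m : ℕ} (P : V →ₗ[ZMod 2] V) (ℓ : Fin m → V →ₗ[ZMod 2] ZMod 2)
    (v : Fin m → V) (h : ∀ x, x = P x + ∑ j, ℓ j x • v j) :
    PrankDecompOn k univ (k * m) (fun x => α x + α fun i => P (x i)) := by
  let Q : ℕ → Fin k → V →ₗ[ZMod 2] V := fun s i => if i.val < s then P else LinearMap.id
  have key : ∀ s ≤ k, PrankDecompOn k univ (s * m) (fun x => α x + α fun i => Q s i (x i)) := by
    intro s
    induction s with
    | zero =>
      intro _
      simpa [Q, CharTwo.add_self_eq_zero] using PrankDecompOn.zero (V := V) (k := k) univ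
    | succ s ih =>
      intro hs
      let p : Fin k := ⟨s, hs⟩
      have step : PrankDecompOn k univ (m * 1)
          (fun x => ∑ j, ℓ j (x p) * α (Function.update (fun i => Q s i (x i)) p (v j))) := by
        refine PrankDecompOn.sum fun j => PrankDecompOn.mul (I := {p}) (subset_univ _)
          (singleton_ne_empty _) (fun hp => ?_) (multilinearOn_linear _ _)
          ((hα.update p (v j)).comp (Q s))
        have := congrArg Finset.card hp
        simp only [card_singleton, card_univ, Fintype.card_fin] at this
        omega
      convert (ih (by omega)).add step using 1
      · ring
      · funext x
        have hQ : (fun i => Q (s + 1) i (x i)) =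
            Function.update (fun i => Q s i (x i)) p (P (x p)) := by
          funext i
          by_cases hi : i = p
          · subst hi
            simp [Q, p]
          · have hi' : i.val ≠ s := fun h => hi (Fin.ext h)
            simp [Q, hi, le_iff_lt_or_eq, hi']
        have hQ' : (fun i => Q s i (x i)) = Function.update (fun i => Q s i (x i)) p (x p) := by
          funext i
          by_cases hi : i = p
          · subst hi
            simp [Q, p]
          · simp [hi]
        have e : α (fun i => Q s i (x i)) = α (fun i => Q (s + 1) i (x i)) +
            ∑ j, ℓ j (x p) * α (Function.update (fun i => Q s i (x i)) p (v j)) := by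
          have hα' : MultilinearOn k univ α := hα
          have := congrArg (hα'.slice (mem_univ p) fun i => Q s i (x i)) (h (x p))
          rw [map_add, map_sum] at this
          simpa only [map_smul, smul_eq_mul, MultilinearOn.slice_apply, ← hQ, ← hQ'] using this
        rw [e, add_assoc (α x), add_assoc, CharTwo.add_self_eq_zero, add_zero]
  simpa [Q] using key k le_rfl

end Decompositions

section FiveVariables

variable {V : Type*} [AddCommGroup V] [Module (ZMod 2) V]

/-- The variables of the bilinear factors in `pairSum`. -/
def pairIndex : Fin 10 → Fin 5 × Fin 5 :=
  ![(0, 1), (0, 2), (1, 2), (0, 3), (1, 3), (2, 3), (0, 4), (1, 4), (2, 4), (3, 4)]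

/-- The variables of the trilinear factors in `pairSum`. -/
def tripleIndex : Fin 10 → Fin 5 × Fin 5 × Fin 5 :=
  ![(2, 3, 4), (1, 3, 4), (0, 3, 4), (1, 2, 4), (0, 2, 4), (0, 1, 4), (1, 2, 3), (0, 2, 3),
    (0, 1, 3), (0, 1, 2)]

lemma pairSum_single (w : V →ₗ[ZMod 2] V →ₗ[ZMod 2] ZMod 2)
    (T : V →ₗ[ZMod 2] V →ₗ[ZMod 2] V →ₗ[ZMod 2] ZMod 2) (p : Fin 10) (x : Fin 5 → V) :
    pairSum w (Pi.single p T) (x 0) (x 1) (x 2) (x 3) (x 4) =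
      w (x (pairIndex p).1) (x (pairIndex p).2) *
        T (x (tripleIndex p).1) (x (tripleIndex p).2.1) (x (tripleIndex p).2.2) := by
  fin_cases p <;> simp [pairSum, pairIndex, tripleIndex]

lemma finset_fin_five_cases : ∀ I : Finset (Fin 5), I ≠ ∅ → I ≠ univ →
    (∃ k, I = {k} ∨ univ \ I = {k}) ∨
    ∃ p, (I = {(pairIndex p).1, (pairIndex p).2} ∧
        univ \ I = {(tripleIndex p).1, (tripleIndex p).2.1, (tripleIndex p).2.2}) ∨
      (univ \ I = {(pairIndex p).1, (pairIndex p).2} ∧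
        I = {(tripleIndex p).1, (tripleIndex p).2.1, (tripleIndex p).2.2}) := by
  decide

lemma pairIndex_ne : ∀ p, (pairIndex p).1 ≠ (pairIndex p).2 := by decide

lemma tripleIndex_ne : ∀ p, (tripleIndex p).1 ≠ (tripleIndex p).2.1 ∧
    (tripleIndex p).1 ≠ (tripleIndex p).2.2 ∧ (tripleIndex p).2.1 ≠ (tripleIndex p).2.2 := by
  decide

/-- On the kernel of one linear form, every term of a decomposition of a form in five variables
is a product of a bilinear and a trilinear form. -/
lemma exists_eq_pairSum {I : Finset (Fin 5)} (h0 : I ≠ ∅) (h1 : I ≠ univ)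
    {β γ : (Fin 5 → V) → ZMod 2} (hβ : MultilinearOn 5 I β) (hγ : MultilinearOn 5 (univ \ I) γ) :
    ∃ (ℓ : Module.Dual (ZMod 2) V) (w : V →ₗ[ZMod 2] V →ₗ[ZMod 2] ZMod 2)
      (Γ : Fin 10 → V →ₗ[ZMod 2] V →ₗ[ZMod 2] V →ₗ[ZMod 2] ZMod 2),
      ∀ x : Fin 5 → V, (∀ i, ℓ (x i) = 0) →
        β x * γ x = pairSum w Γ (x 0) (x 1) (x 2) (x 3) (x 4) := by
  obtain ⟨k, hk | hk⟩ | ⟨p, ⟨hp, hp'⟩ | ⟨hp, hp'⟩⟩ := finset_fin_five_cases I h0 h1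
  · obtain ⟨ℓ, hℓ⟩ := (hk ▸ hβ).exists_linear
    exact ⟨ℓ, 0, 0, fun x hx => by simp [hℓ, hx, pairSum]⟩
  · obtain ⟨ℓ, hℓ⟩ := (hk ▸ hγ).exists_linear
    exact ⟨ℓ, 0, 0, fun x hx => by simp [hℓ, hx, pairSum]⟩
  · obtain ⟨w, hw⟩ := (hp ▸ hβ).exists_bilinear (pairIndex_ne p)
    obtain ⟨T, hT⟩ := (hp' ▸ hγ).exists_trilinear (tripleIndex_ne p).1 (tripleIndex_ne p).2.1
      (tripleIndex_ne p).2.2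
    exact ⟨0, w, Pi.single p T, fun x _ => by rw [pairSum_single, hw, hT]⟩
  · obtain ⟨w, hw⟩ := (hp ▸ hγ).exists_bilinear (pairIndex_ne p)
    obtain ⟨T, hT⟩ := (hp' ▸ hβ).exists_trilinear (tripleIndex_ne p).1 (tripleIndex_ne p).2.1
      (tripleIndex_ne p).2.2
    exact ⟨0, w, Pi.single p T, fun x _ => by rw [pairSum_single, hw, hT, mul_comm]⟩

lemma prankDecompOn_bilinear_mul_trilinear (w : V →ₗ[ZMod 2] V →ₗ[ZMod 2] ZMod 2)
    (T : V →ₗ[ZMod 2] V →ₗ[ZMod 2] V →ₗ[ZMod 2] ZMod 2) (p : Fin 5 × Fin 5)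
    (t : Fin 5 × Fin 5 × Fin 5) (hp : p.1 ≠ p.2) (h₁ : t.1 ≠ t.2.1) (h₂ : t.1 ≠ t.2.2)
    (h₃ : t.2.1 ≠ t.2.2) (hpt : univ \ {p.1, p.2} = ({t.1, t.2.1, t.2.2} : Finset (Fin 5))) :
    PrankDecompOn 5 univ 1 fun x => w (x p.1) (x p.2) * T (x t.1) (x t.2.1) (x t.2.2) := by
  refine PrankDecompOn.mul (subset_univ _) (insert_ne_empty _ _) (fun h => ?_)
    (multilinearOn_bilinear w hp) ?_
  · have := congrArg Finset.card h
    simp [hp] at this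
  · rw [hpt]
    exact multilinearOn_trilinear T h₁ h₂ h₃

lemma prankDecompOn_correction (w c s : V →ₗ[ZMod 2] V →ₗ[ZMod 2] ZMod 2)
    (Q L : V →ₗ[ZMod 2] V →ₗ[ZMod 2] V →ₗ[ZMod 2] ZMod 2) :
    PrankDecompOn 5 univ 9 fun x => correction w c s Q L (x 0) (x 1) (x 2) (x 3) (x 4) := by
  have term : ∀ w T (p : Fin 5 × Fin 5) (t : Fin 5 × Fin 5 × Fin 5), _ :=
    prankDecompOn_bilinear_mul_trilinear (V := V)
  exact ((((((((term c Q (0, 3) (1, 2, 4) (by decide) (by decide) (by decide) (by decide)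
    (by decide)).add
    (term c Q (1, 3) (0, 2, 4) (by decide) (by decide) (by decide) (by decide) (by decide))).add
    (term c Q (2, 3) (0, 1, 4) (by decide) (by decide) (by decide) (by decide) (by decide))).add
    (term s Q (0, 1) (2, 3, 4) (by decide) (by decide) (by decide) (by decide) (by decide))).add
    (term s Q (0, 2) (1, 3, 4) (by decide) (by decide) (by decide) (by decide) (by decide))).add
    (term s Q (1, 2) (0, 3, 4) (by decide) (by decide) (by decide) (by decide) (by decide))).add
    (term w L (2, 4) (0, 1, 3) (by decide) (by decide) (by decide) (by decide) (by decide))).add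
    (term w L (1, 4) (0, 2, 3) (by decide) (by decide) (by decide) (by decide) (by decide))).add
    (term w L (0, 4) (1, 2, 3) (by decide) (by decide) (by decide) (by decide) (by decide))

/-- A function of five variables invariant under three adjacent transpositions is symmetric in
its first four variables. -/
lemma symmetricInFirst_four {V : Type*} {F : V → V → V → V → V → ZMod 2} {P : V → V}
    (h : ∀ a b c d y, F (P a) (P b) (P c) (P d) (P y) = F (P b) (P a) (P c) (P d) (P y) ∧
      F (P a) (P b) (P c) (P d) (P y) = F (P a) (P c) (P b) (P d) (P y) ∧
      F (P a) (P b) (P c) (P d) (P y) = F (P a) (P b) (P d) (P c) (P y)) :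
    SymmetricInFirst 5 4 fun x : Fin 5 → V =>
      F (P (x 0)) (P (x 1)) (P (x 2)) (P (x 3)) (P (x 4)) := by
  have h12 := fun a b c d y => (h a b c d y).1
  have h23 := fun a b c d y => (h a b c d y).2.1
  have h34 := fun a b c d y => (h a b c d y).2.2
  have h13 : ∀ a b c d y, F (P a) (P b) (P c) (P d) (P y) = F (P c) (P b) (P a) (P d) (P y) :=
    fun a b c d y => by rw [h12 a, h23 b, h12 b]
  have h24 : ∀ a b c d y, F (P a) (P b) (P c) (P d) (P y) = F (P a) (P d) (P c) (P b) (P y) :=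
    fun a b c d y => by rw [h23 a, h34 a, h23 a]
  have h14 : ∀ a b c d y, F (P a) (P b) (P c) (P d) (P y) = F (P d) (P b) (P c) (P a) (P y) :=
    fun a b c d y => by rw [h12 a, h24 b, h12 b]
  intro i j hi hj
  funext x
  simp only [permForm, Equiv.symm_swap]
  fin_cases i <;> fin_cases j
  all_goals first
    | exact absurd hi (by decide)
    | exact absurd hj (by decide)
    | simp only [Equiv.swap_apply_def]
  all_goals first
    | rfl
    | exact (h12 _ _ _ _ _).symm
    | exact (h23 _ _ _ _ _).symm
    | exact (h34 _ _ _ _ _).symm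
    | exact (h13 _ _ _ _ _).symm
    | exact (h24 _ _ _ _ _).symm
    | exact (h14 _ _ _ _ _).symm

lemma isMultilinear_permForm {k : ℕ} {α : (Fin k → V) → ZMod 2} (hα : IsMultilinear k α)
    (π : Equiv.Perm (Fin k)) : IsMultilinear k (permForm k π α) := by
  refine ⟨fun x y h => hα.1 _ _ fun i _ => h _ (mem_univ _), fun i _ x u v => ?_⟩
  have e : ∀ u, permForm k π α (Function.update x i u) =
      α (Function.update (x ∘ π.symm) (π i) u) := fun u =>
    congrArg α (Function.update_comp_equiv x π.symm i u)
  rw [e, e, e]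
  exact hα.2 _ (mem_univ _) _ _ _

lemma IsMultilinear.exists_prankDecompOn {k n : ℕ} (hk : 2 ≤ k)
    {α : (Fin k → (Fin n → ZMod 2)) → ZMod 2} (hα : IsMultilinear k α) :
    ∃ m, PrankDecompOn k univ m α := by
  have h := hα.prankDecompOn_add_comp hk 0 (fun j => LinearMap.proj j)
    (fun j => Pi.single j 1) fun x => by
      simpa [← Pi.single_smul] using (Finset.univ_sum_single x).symm
  have h0 : α (fun _ => 0) = 0 := by
    have hα' : MultilinearOn k univ α := hα
    have e := map_zero (hα'.slice (mem_univ (⟨0, by omega⟩ : Fin k)) fun _ => 0)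
    rwa [MultilinearOn.slice_apply, Function.update_eq_self_iff.2 rfl] at e
  exact ⟨_, by simpa [h0] using h⟩

/-- Symmetry extension with a polynomial bound. -/
theorem exists_symmetricInFirst_four {n : ℕ} {α : (Fin 5 → (Fin n → ZMod 2)) → ZMod 2}
    (hα : IsMultilinear 5 α) (hsymm : SymmetricInFirst 5 3 α) {r : ℕ}
    (hr : prank 5 (α + permForm 5 (Equiv.swap 2 3) α) ≤ r) :
    ∃ α' : (Fin 5 → (Fin n → ZMod 2)) → ZMod 2, IsMultilinear 5 α' ∧ SymmetricInFirst 5 4 α' ∧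
      prank 5 (α + α') ≤ 5 * (r + 1280 * r ^ 2) + 9 * r := by
  classical
  obtain ⟨I, β, γ, -, h0, h1, hβ, hγ, hφ⟩ :
      PrankDecompOn 5 univ (prank 5 (α + permForm 5 (Equiv.swap 2 3) α))
        (α + permForm 5 (Equiv.swap 2 3) α) :=
    Nat.sInf_mem (IsMultilinear.exists_prankDecompOn (by norm_num)
      (MultilinearOn.add hα (isMultilinear_permForm hα _)))
  generalize prank 5 (α + permForm 5 (Equiv.swap 2 3) α) = N at *
  choose ℓ w Γ h using fun i => exists_eq_pairSum (h0 i) (h1 i) (hβ i) (hγ i)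
  have hS₀ : (univ.image ℓ).card ≤ N := card_image_le.trans (by simp)
  have perm : ∀ (i j : Fin 5) a b c d y, (i : ℕ) < 3 → (j : ℕ) < 3 →
      α ![a, b, c, d, y] = α (fun p => ![a, b, c, d, y] (Equiv.swap i j p)) :=
    fun i j a b c d y hi hj => (congrFun (hsymm i j hi hj) ![a, b, c, d, y]).symm
  have h12 : ∀ a b c d y, α ![a, b, c, d, y] = α ![b, a, c, d, y] := fun a b c d y =>
    (perm 0 1 a b c d y (by simp) (by simp)).trans (congrArg α (by
      funext p
      fin_cases p <;> rfl))
  have h23 : ∀ a b c d y, α ![a, b, c, d, y] = α ![a, c, b, d, y] := fun a b c d y =>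
    (perm 1 2 a b c d y (by simp) (by simp)).trans (congrArg α (by
      funext p
      fin_cases p <;> rfl))
  obtain ⟨S, c, s, Q, L, hS, hF⟩ := exists_correction (univ.image ℓ)
    (fun a b c d y => α ![a, b, c, d, y]) h12 h23
    w Γ (by
      intro a b c d y ha hb hc hd hy
      simp only [mem_image, mem_univ, true_and, forall_exists_index, forall_apply_eq_imp_iff]
        at ha hb hc hd hy
      refine Eq.trans ?_ ((hφ ![a, b, c, d, y]).trans (Finset.sum_congr rfl fun i _ => h i _ ?_))
      · refine congrArg (α ![a, b, c, d, y] + ·) (congrArg α ?_)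
        funext p
        fin_cases p <;> rfl
      · intro p
        fin_cases p
        exacts [ha i, hb i, hc i, hd i, hy i])
  obtain ⟨m, hm, P, l, v, hP, hx⟩ := exists_map_into_kernel S
  let ψ : (Fin 5 → (Fin n → ZMod 2)) → ZMod 2 := fun x =>
    ∑ i, correction (w i) (c i) (s i) (Q i) (L i) (P (x 0)) (P (x 1)) (P (x 2)) (P (x 3)) (P (x 4))
  have hψ : PrankDecompOn 5 univ (N * 9) ψ :=
    PrankDecompOn.sum fun i => (prankDecompOn_correction _ _ _ _ _).comp fun _ => P
  refine ⟨fun x => α (fun i => P (x i)) + ψ x, (hα.comp fun _ => P).add hψ.multilinearOn, ?_, ?_⟩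
  · have key := symmetricInFirst_four (P := P) (F := fun x₁ x₂ x₃ x₄ y => α ![x₁, x₂, x₃, x₄, y] +
      ∑ i, correction (w i) (c i) (s i) (Q i) (L i) x₁ x₂ x₃ x₄ y) fun a b c d y => by
        obtain ⟨e1, e2, e3⟩ := hF _ _ _ _ _ (hP a) (hP b) (hP c) (hP d) (hP y)
        exact ⟨congrArg₂ _ (h12 _ _ _ _ _) e1, congrArg₂ _ (h23 _ _ _ _ _) e2, e3⟩
    convert key using 4 with x
    funext p
    fin_cases p <;> rfl
  · have hD := (hα.prankDecompOn_add_comp (by norm_num) P l v hx).add hψ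
    refine (Nat.sInf_le (m := 5 * m + N * 9) ?_).trans ?_
    · refine (congrArg (PrankDecompOn 5 univ (5 * m + N * 9)) ?_).mpr hD
      funext x
      simp [add_assoc]
    · have : 1280 * N ^ 2 ≤ 1280 * r ^ 2 := by gcongr
      omega

end FiveVariables

lemma polynomial_le_exp_exp (r : ℕ) :
    ((5 * (r + 1280 * r ^ 2) + 9 * r : ℕ) : ℝ) ≤
      Real.exp (Real.exp ((100 : ℝ) * (r : ℝ) ^ (100 : ℝ))) := by
  obtain rfl | hr := Nat.eq_zero_or_pos r
  · simpa using Real.exp_nonneg _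
  · have h1 : (1 : ℝ) ≤ r := by exact_mod_cast hr
    have h2 : (r : ℝ) ≤ (r : ℝ) ^ (100 : ℝ) := Real.self_le_rpow_of_one_le h1 (by norm_num)
    have h3 : (100 * r : ℝ) ^ 3 / (Nat.factorial 3 : ℕ) ≤ Real.exp (100 * r) :=
      Real.pow_div_factorial_le_exp _ (by positivity) 3
    have h4 : Real.exp (100 * r) ≤ Real.exp (100 * (r : ℝ) ^ (100 : ℝ)) := by gcongr
    have h5 := Real.add_one_le_exp (Real.exp (100 * (r : ℝ) ^ (100 : ℝ)))
    have h6 : (r : ℝ) ^ 2 ≤ (r : ℝ) ^ 3 := pow_le_pow_right₀ h1 (by norm_num)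
    have h7 : (r : ℝ) ≤ (r : ℝ) ^ 3 := le_self_pow₀ h1 (by norm_num)
    push_cast [Nat.factorial] at h3 ⊢
    linarith [show (100 * r : ℝ) ^ 3 = 1000000 * (r : ℝ) ^ 3 by ring]

/-- **Theorem 7 (symmetry extension for 5-variable forms).**
There is an absolute constant `C ≥ 1` such that: if `α : G⁵ → 𝔽₂` is multilinear,
symmetric in its first three variables, and `prank(α + α∘(3 4)) ≤ r`, then some
multilinear form `α'` symmetric in its first four variables satisfies
`prank(α + α') ≤ exp(exp(C·r^C))`. -/
theorem statement4 :
    ∃ C : ℝ, 1 ≤ C ∧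
      ∀ (n : ℕ) (α : (Fin 5 → (Fin n → ZMod 2)) → ZMod 2), IsMultilinear 5 α →
        SymmetricInFirst 5 3 α →
        ∀ r : ℕ, prank 5 (α + permForm 5 (Equiv.swap 2 3) α) ≤ r →
          ∃ α' : (Fin 5 → (Fin n → ZMod 2)) → ZMod 2,
            IsMultilinear 5 α' ∧ SymmetricInFirst 5 4 α' ∧
            (prank 5 (α + α') : ℝ) ≤ Real.exp (Real.exp (C * (r : ℝ) ^ C)) := by
  refine ⟨100, by norm_num, fun n α hα hsymm r hr => ?_⟩
  obtain ⟨α', h1, h2, h3⟩ := exists_symmetricInFirst_four hα hsymm hr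
  exact ⟨α', h1, h2, (Nat.cast_le.2 h3).trans (polynomial_le_exp_exp r)⟩
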